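/- (Expanding universe, Theorem 2.) Assume (A0) and (A1). Let $(a,\rho)$ be the solution of the Friedmann system with initial data $a(0)=a_0>0$, $a'(0)=\dot a_0$, $\rho(0)=\rho_0>0$, on its maximal interval of existence $]t_-,t_+[$ in $\{a>0,\ \rho>0\}$. If $\dot a_0>0$ and $4\pi G(\rho_0+3P(\rho_0)/c^2)\le c^2\Lambda$, then $t_+=+\infty$, and $a(t)\to+\infty$ and $\rho(t)\to 0$ as $t\to+\infty$. -/

import Mathlib

open Real Filter Set Topology Asymptotics

/-- Assumption (A0): `P` is a smooth function of `ρ > 0` with `0 ≤ P`,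
`0 ≤ dP/dρ < c²` for `ρ > 0`, and `P → 0` as `ρ → 0⁺`. -/
def A0 (c : ℝ) (P : ℝ → ℝ) : Prop :=
  ContDiffOn ℝ (⊤ : ℕ∞) P (Set.Ioi 0) ∧
  (∀ ρ > (0 : ℝ), 0 ≤ P ρ) ∧
  (∀ ρ > (0 : ℝ), 0 ≤ deriv P ρ ∧ deriv P ρ < c ^ 2) ∧
  Filter.Tendsto P (nhdsWithin 0 (Set.Ioi 0)) (nhds 0)

/-- A solution of the Friedmann system on a set `I`: `a > 0`, `ρ > 0`,
`a'' = (-(4πG/3)(ρ + 3P(ρ)/c²) + c²Λ/3) a` and `ρ' = -3(ρ + P(ρ)/c²) a'/a`. -/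
def IsFriedmannSolution (c G Λ : ℝ) (P : ℝ → ℝ) (a ρ : ℝ → ℝ) (I : Set ℝ) : Prop :=
  ∀ t ∈ I, 0 < a t ∧ 0 < ρ t ∧
    DifferentiableAt ℝ a t ∧
    HasDerivAt (deriv a)
      ((-(4 * Real.pi * G / 3) * (ρ t + 3 * P (ρ t) / c ^ 2) + c ^ 2 * Λ / 3) * a t) t ∧
    HasDerivAt ρ (-3 * (ρ t + P (ρ t) / c ^ 2) * (deriv a t / a t)) t

/-- `(a, ρ)` is a solution of the Friedmann system on the maximal interval of existence
`]t₋, t₊[` (with `-∞ ≤ t₋ < 0 < t₊ ≤ +∞`) in the domain `{a > 0, ρ > 0}`: the solution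
property holds on `]t₋, t₊[`, and any solution with the same initial data at `t = 0`
is defined on a subinterval of `]t₋, t₊[`. -/
def IsMaximalSolution (c G Λ : ℝ) (P : ℝ → ℝ) (a ρ : ℝ → ℝ) (tm tp : EReal) : Prop :=
  tm < (0 : EReal) ∧ (0 : EReal) < tp ∧
  IsFriedmannSolution c G Λ P a ρ {t : ℝ | tm < (t : EReal) ∧ (t : EReal) < tp} ∧
  ∀ (b σ : ℝ → ℝ) (s u : ℝ), s < 0 → 0 < u →
    IsFriedmannSolution c G Λ P b σ (Set.Ioo s u) →
    b 0 = a 0 → deriv b 0 = deriv a 0 → σ 0 = ρ 0 →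
    tm ≤ (s : EReal) ∧ (u : EReal) ≤ tp

/-- Assumption (A1): there are `1 ≤ Γ < 2` and `0 < σ ≤ 1` such that
`P(ρ) = (Γ-1) c² ρ (1 + O(ρ^{-σ}))` as `ρ → +∞`. -/
def A1 (c : ℝ) (P : ℝ → ℝ) (Γ σ : ℝ) : Prop :=
  1 ≤ Γ ∧ Γ < 2 ∧ 0 < σ ∧ σ ≤ 1 ∧
  ∃ E : ℝ → ℝ, (∀ᶠ ρ in Filter.atTop, P ρ = (Γ - 1) * c ^ 2 * ρ * (1 + E ρ)) ∧
    E =O[Filter.atTop] fun ρ : ℝ => ρ ^ (-σ)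

/-- The pressure is nondecreasing in the density. -/
lemma A0.monotoneOn {c : ℝ} {P : ℝ → ℝ} (hP : A0 c P) : MonotoneOn P (Set.Ioi 0) := by
  obtain ⟨hsmooth, -, hder, -⟩ := hP
  refine monotoneOn_of_deriv_nonneg (convex_Ioi 0) hsmooth.continuousOn ?_ ?_
  · rw [interior_Ioi]
    exact hsmooth.differentiableOn (by simp)
  · rw [interior_Ioi]
    exact fun x hx => (hder x hx).1

/-- The dominant energy condition `P(ρ) ≤ c² ρ`. -/
lemma A0.le_mul {c : ℝ} {P : ℝ → ℝ} (hP : A0 c P) {r : ℝ} (hr : 0 < r) : P r ≤ c ^ 2 * r := by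
  obtain ⟨hsmooth, -, hder, hlim⟩ := hP
  have hdiff : DifferentiableOn ℝ P (Set.Ioi 0) := hsmooth.differentiableOn (by simp)
  have hanti : AntitoneOn (fun x => P x - c ^ 2 * x) (Set.Ioi 0) := by
    refine antitoneOn_of_hasDerivWithinAt_nonpos (convex_Ioi 0)
      (f' := fun x => deriv P x - c ^ 2)
      (hsmooth.continuousOn.sub (continuousOn_const.mul continuousOn_id)) ?_ ?_
    · rw [interior_Ioi]
      intro x hx
      have h := ((hdiff x hx).differentiableAt (Ioi_mem_nhds hx)).hasDerivAt.fun_sub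
        ((hasDerivAt_id x).const_mul (c ^ 2))
      simpa using h.hasDerivWithinAt
    · rw [interior_Ioi]
      exact fun x hx => by linarith [(hder x hx).2]
  have hlim' : Tendsto (fun x => P x - c ^ 2 * x) (𝓝[>] 0) (𝓝 0) := by
    have h : Tendsto (fun x : ℝ => c ^ 2 * x) (𝓝[>] 0) (𝓝 (c ^ 2 * 0)) :=
      ((continuous_const.mul continuous_id).tendsto 0).mono_left nhdsWithin_le_nhds
    simpa using hlim.sub h
  have hle : P r - c ^ 2 * r ≤ 0 := by
    refine ge_of_tendsto hlim' ?_
    filter_upwards [Ioo_mem_nhdsGT hr] with x hx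
    exact hanti hx.1 hr hx.2.le
  linarith

/-- A trajectory of a `C¹` autonomous vector field which has a limit at the right end of its
interval of definition can be continued beyond it. -/
lemma exists_trajectory_extension {E : Type*} [NormedAddCommGroup E] [NormedSpace ℝ E]
    [CompleteSpace E] {f : E → E} {x₀ : E} (hf : ContDiffAt ℝ 1 f x₀) {X : ℝ → E} {s T : ℝ}
    (hsT : s < T) (hX : ∀ t ∈ Set.Ioo s T, HasDerivAt X (f (X t)) t)
    (hlim : Tendsto X (𝓝[<] T) (𝓝 x₀)) :
    ∃ (Y : ℝ → E) (ε : ℝ), 0 < ε ∧ EqOn Y X (Set.Iio T) ∧ Y T = x₀ ∧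
      ∀ t ∈ Set.Ioo s (T + ε), HasDerivAt Y (f (Y t)) t := by
  obtain ⟨α, hα, ε, hε, hderiv⟩ :=
    hf.exists_forall_mem_closedBall_exists_eq_forall_mem_Ioo_hasDerivAt₀ T
  set Y : ℝ → E := fun t => if t < T then X t else α t
  have hYX : EqOn Y X (Set.Iio T) := fun t ht => if_pos ht
  have hYα : EqOn Y α (Set.Ici T) := fun t ht => if_neg (not_lt.mpr ht)
  have hYT : Y T = x₀ := by rw [hYα self_mem_Ici, hα]
  have hleft : ∀ t ∈ Set.Ioo s T, HasDerivAt Y (f (Y t)) t := by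
    intro t ht
    rw [hYX ht.2]
    exact (hX t ht).congr_of_eventuallyEq (hYX.eventuallyEq_of_mem (Iio_mem_nhds ht.2))
  refine ⟨Y, ε, hε, hYX, hYT, fun t ht => ?_⟩
  rcases lt_trichotomy t T with h | rfl | h
  · exact hleft t ⟨ht.1, h⟩
  · have hev : Y =ᶠ[𝓝[<] t] X := hYX.eventuallyEq_of_mem self_mem_nhdsWithin
    have hYlim : Tendsto Y (𝓝[<] t) (𝓝 x₀) := hlim.congr' hev.symm
    have hmem : Set.Ioo s t ∈ 𝓝[<] t := Ioo_mem_nhdsLT hsT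
    have h₁ : HasDerivWithinAt Y (f (Y t)) (Set.Iic t) t := by
      refine hasDerivWithinAt_Iic_of_tendsto_deriv
        (fun x hx => (hleft x hx).differentiableAt.differentiableWithinAt) ?_ hmem ?_
      · rw [ContinuousWithinAt, hYT]
        exact hYlim.mono_left (nhdsWithin_mono _ fun x hx => hx.2)
      · rw [hYT]
        refine (hf.continuousAt.tendsto.comp hYlim).congr' ?_
        filter_upwards [hmem] with x hx
        exact (hleft x hx).deriv.symm
    have h₂ : HasDerivWithinAt Y (f (Y t)) (Set.Ici t) t := by
      rw [hYα self_mem_Ici]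
      exact (hderiv t ⟨by linarith, by linarith⟩).hasDerivWithinAt.congr hYα (hYα self_mem_Ici)
    simpa using h₁.union h₂
  · rw [hYα h.le]
    exact (hderiv t ⟨by linarith, ht.2⟩).congr_of_eventuallyEq
      (hYα.eventuallyEq_of_mem (Ici_mem_nhds h))

/-- The vector field of the Friedmann system in the variables `(a, a', ρ)`. -/
noncomputable def friedmannField (c G Λ : ℝ) (P : ℝ → ℝ) (x : ℝ × ℝ × ℝ) : ℝ × ℝ × ℝ :=
  (x.2.1,
    (-(4 * Real.pi * G / 3) * (x.2.2 + 3 * P x.2.2 / c ^ 2) + c ^ 2 * Λ / 3) * x.1,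
    -3 * (x.2.2 + P x.2.2 / c ^ 2) * (x.2.1 / x.1))

lemma contDiffAt_friedmannField (c G Λ : ℝ) {P : ℝ → ℝ} (hP : A0 c P) {x : ℝ × ℝ × ℝ}
    (hx : 0 < x.1) (hx' : 0 < x.2.2) : ContDiffAt ℝ 1 (friedmannField c G Λ P) x := by
  have hPx : ContDiffAt ℝ 1 P x.2.2 :=
    ((hP.1 x.2.2 hx').contDiffAt (Ioi_mem_nhds hx')).of_le (by exact_mod_cast le_top)
  have hPc : ContDiffAt ℝ 1 (fun y : ℝ × ℝ × ℝ => P y.2.2) x :=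
    hPx.comp x (contDiff_snd.snd.contDiffAt)
  have h₁ : ContDiffAt ℝ 1 (fun y : ℝ × ℝ × ℝ => y.1) x := contDiff_fst.contDiffAt
  have h₂ : ContDiffAt ℝ 1 (fun y : ℝ × ℝ × ℝ => y.2.1) x := contDiff_snd.fst.contDiffAt
  have h₃ : ContDiffAt ℝ 1 (fun y : ℝ × ℝ × ℝ => y.2.2) x := contDiff_snd.snd.contDiffAt
  unfold friedmannField
  refine h₂.prodMk (ContDiffAt.prodMk ?_ ?_)
  · exact ((contDiffAt_const.mul (h₃.add ((contDiffAt_const.mul hPc).div_const _))).add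
      contDiffAt_const).mul h₁
  · exact (contDiffAt_const.mul (h₃.add (hPc.div_const _))).mul (h₂.div h₁ hx.ne')

/-- A solution of the Friedmann system for which `a`, `a'`, `ρ` have limits at the right end of its
interval, with positive limits for `a` and `ρ`, can be continued beyond it. -/
lemma IsFriedmannSolution.exists_extension {c G Λ : ℝ} {P a ρ : ℝ → ℝ} {s T A V R : ℝ}
    (hP : A0 c P) (hsT : s < T) (hsol : IsFriedmannSolution c G Λ P a ρ (Set.Ioo s T))
    (hA : 0 < A) (hR : 0 < R) (ha : Tendsto a (𝓝[<] T) (𝓝 A))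
    (hv : Tendsto (deriv a) (𝓝[<] T) (𝓝 V)) (hρ : Tendsto ρ (𝓝[<] T) (𝓝 R)) :
    ∃ (b σ : ℝ → ℝ) (u : ℝ), T < u ∧ IsFriedmannSolution c G Λ P b σ (Set.Ioo s u) ∧
      EqOn b a (Set.Iio T) ∧ EqOn σ ρ (Set.Iio T) := by
  obtain ⟨Y, ε, hε, hYX, hYT, hY⟩ := exists_trajectory_extension
    (contDiffAt_friedmannField c G Λ hP (x := (A, V, R)) hA hR)
    (X := fun t => (a t, deriv a t, ρ t)) hsT
    (fun t ht => by
      obtain ⟨-, -, h₁, h₂, h₃⟩ := hsol t ht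
      exact h₁.hasDerivAt.prodMk (h₂.prodMk h₃))
    (ha.prodMk_nhds (hv.prodMk_nhds hρ))
  have hcont : ContinuousAt Y T := (hY T ⟨hsT, by linarith⟩).continuousAt
  have hpos : ∀ᶠ t in 𝓝 T, 0 < (Y t).1 ∧ 0 < (Y t).2.2 := by
    refine (hcont.fst.eventually (lt_mem_nhds ?_)).and
      (hcont.snd.snd.eventually (lt_mem_nhds ?_))
    · simpa [hYT] using hA
    · simpa [hYT] using hR
  obtain ⟨δ, hδ, hball⟩ := Metric.eventually_nhds_iff.mp hpos
  have hu : ∀ t ∈ Set.Ioo s (T + min ε δ), t ∈ Set.Ioo s (T + ε) :=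
    fun t ht => ⟨ht.1, ht.2.trans_le (by gcongr; exact min_le_left _ _)⟩
  have hd₁ : ∀ t ∈ Set.Ioo s (T + min ε δ), HasDerivAt (fun t => (Y t).1) (Y t).2.1 t :=
    fun t ht => (hY t (hu t ht)).hasFDerivAt.fst.hasDerivAt.congr_deriv
      (by simp [friedmannField])
  have hd₂ : ∀ t ∈ Set.Ioo s (T + min ε δ), HasDerivAt (fun t => (Y t).2.1)
      ((-(4 * Real.pi * G / 3) * ((Y t).2.2 + 3 * P (Y t).2.2 / c ^ 2) + c ^ 2 * Λ / 3)
        * (Y t).1) t :=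
    fun t ht => (hY t (hu t ht)).hasFDerivAt.snd.fst.hasDerivAt.congr_deriv
      (by simp [friedmannField])
  have hd₃ : ∀ t ∈ Set.Ioo s (T + min ε δ), HasDerivAt (fun t => (Y t).2.2)
      (-3 * ((Y t).2.2 + P (Y t).2.2 / c ^ 2) * ((Y t).2.1 / (Y t).1)) t :=
    fun t ht => (hY t (hu t ht)).hasFDerivAt.snd.snd.hasDerivAt.congr_deriv
      (by simp [friedmannField])
  refine ⟨fun t => (Y t).1, fun t => (Y t).2.2, T + min ε δ, by simp [hε, hδ], ?_,
    fun t ht => by simp [hYX ht], fun t ht => by simp [hYX ht]⟩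
  intro t ht
  have hpt : 0 < (Y t).1 ∧ 0 < (Y t).2.2 := by
    rcases lt_or_ge t T with h | h
    · have := hsol t ⟨ht.1, h⟩
      simpa [hYX h] using And.intro this.1 this.2.1
    · refine hball ?_
      rw [Real.dist_eq, abs_of_nonneg (by linarith)]
      linarith [ht.2, min_le_right ε δ]
  have hderiv : deriv (fun t => (Y t).1) =ᶠ[𝓝 t] fun t => (Y t).2.1 := by
    filter_upwards [Ioo_mem_nhds ht.1 ht.2] with x hx
    exact (hd₁ x hx).deriv
  refine ⟨hpt.1, hpt.2, (hd₁ t ht).differentiableAt,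
    (hd₂ t ht).congr_of_eventuallyEq hderiv, ?_⟩
  rw [hderiv.eq_of_nhds]
  exact hd₃ t ht

namespace IsFriedmannSolution

variable {c G Λ : ℝ} {P a ρ : ℝ → ℝ} {D : Set ℝ}

lemma mono {I : Set ℝ} (hsol : IsFriedmannSolution c G Λ P a ρ I) (h : D ⊆ I) :
    IsFriedmannSolution c G Λ P a ρ D := fun t ht => hsol t (h ht)

lemma hasDerivAt_scale (hsol : IsFriedmannSolution c G Λ P a ρ D) {t : ℝ} (ht : t ∈ D) :
    HasDerivAt a (deriv a t) t := (hsol t ht).2.2.1.hasDerivAt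

lemma continuousOn_scale (hsol : IsFriedmannSolution c G Λ P a ρ D) : ContinuousOn a D :=
  fun _ ht => (hsol.hasDerivAt_scale ht).continuousAt.continuousWithinAt

lemma continuousOn_deriv (hsol : IsFriedmannSolution c G Λ P a ρ D) : ContinuousOn (deriv a) D :=
  fun t ht => (hsol t ht).2.2.2.1.continuousAt.continuousWithinAt

lemma continuousOn_density (hsol : IsFriedmannSolution c G Λ P a ρ D) : ContinuousOn ρ D :=
  fun t ht => (hsol t ht).2.2.2.2.continuousAt.continuousWithinAt

lemma hasDerivAt_density_mul_pow (hsol : IsFriedmannSolution c G Λ P a ρ D) (n : ℕ) {t : ℝ}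
    (ht : t ∈ D) : HasDerivAt (fun t => ρ t * a t ^ n)
      ((n * ρ t - 3 * (ρ t + P (ρ t) / c ^ 2)) * (deriv a t / a t) * a t ^ n) t := by
  obtain ⟨h₀, -, h₁, -, h₂⟩ := hsol t ht
  refine (h₂.fun_mul (h₁.hasDerivAt.fun_pow n)).congr_deriv ?_
  rcases n with _ | n
  · simp
  · simp only [Nat.add_sub_cancel, pow_succ]
    field_simp
    ring

lemma monotoneOn_scale (hsol : IsFriedmannSolution c G Λ P a ρ D) (hD : Convex ℝ D)
    (hv : ∀ t ∈ interior D, 0 ≤ deriv a t) : MonotoneOn a D :=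
  monotoneOn_of_hasDerivWithinAt_nonneg hD hsol.continuousOn_scale
    (fun _ ht => (hsol.hasDerivAt_scale (interior_subset ht)).hasDerivWithinAt) hv

/-- In an expanding universe the density decreases at least as fast as that of dust. -/
lemma antitoneOn_density_mul_pow (hP : A0 c P) (hsol : IsFriedmannSolution c G Λ P a ρ D)
    (hD : Convex ℝ D) (hv : ∀ t ∈ interior D, 0 ≤ deriv a t) {n : ℕ} (hn : n ≤ 3) :
    AntitoneOn (fun t => ρ t * a t ^ n) D := by
  refine antitoneOn_of_hasDerivWithinAt_nonpos hD
    (hsol.continuousOn_density.mul (hsol.continuousOn_scale.pow n))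
    (fun t ht => (hsol.hasDerivAt_density_mul_pow n (interior_subset ht)).hasDerivWithinAt) ?_
  intro t ht
  obtain ⟨ha, hρ, -⟩ := hsol t (interior_subset ht)
  have hPρ : 0 ≤ P (ρ t) / c ^ 2 := div_nonneg (hP.2.1 _ hρ) (sq_nonneg c)
  have hn' : (n : ℝ) ≤ 3 := by exact_mod_cast hn
  refine mul_nonpos_of_nonpos_of_nonneg (mul_nonpos_of_nonpos_of_nonneg ?_
    (div_nonneg (hv t ht) ha.le)) (pow_nonneg ha.le n)
  nlinarith

lemma antitoneOn_density (hP : A0 c P) (hsol : IsFriedmannSolution c G Λ P a ρ D)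
    (hD : Convex ℝ D) (hv : ∀ t ∈ interior D, 0 ≤ deriv a t) : AntitoneOn ρ D := by
  simpa using hsol.antitoneOn_density_mul_pow hP hD hv (Nat.zero_le 3)

/-- In an expanding universe the density decreases at most as fast as that of stiff matter. -/
lemma monotoneOn_density_mul_pow_six (hc : 0 < c) (hP : A0 c P)
    (hsol : IsFriedmannSolution c G Λ P a ρ D) (hD : Convex ℝ D)
    (hv : ∀ t ∈ interior D, 0 ≤ deriv a t) : MonotoneOn (fun t => ρ t * a t ^ 6) D := by
  refine monotoneOn_of_hasDerivWithinAt_nonneg hD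
    (hsol.continuousOn_density.mul (hsol.continuousOn_scale.pow 6))
    (fun t ht => (hsol.hasDerivAt_density_mul_pow 6 (interior_subset ht)).hasDerivWithinAt) ?_
  intro t ht
  obtain ⟨ha, hρ, -⟩ := hsol t (interior_subset ht)
  have hPρ : P (ρ t) / c ^ 2 ≤ ρ t := by
    rw [div_le_iff₀ (by positivity), mul_comm]
    exact hP.le_mul hρ
  refine mul_nonneg (mul_nonneg ?_ (div_nonneg (hv t ht) ha.le)) (pow_nonneg ha.le 6)
  push_cast
  linarith

/-- If the universe expands and the initial acceleration is nonnegative, then the expansion rate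
is nondecreasing. -/
lemma monotoneOn_deriv (hG : 0 < G) (hP : A0 c P) (hsol : IsFriedmannSolution c G Λ P a ρ D)
    (hD : Convex ℝ D) (hv : ∀ t ∈ interior D, 0 ≤ deriv a t) {t₀ : ℝ} (ht₀ : IsLeast D t₀)
    (hcond : 4 * Real.pi * G * (ρ t₀ + 3 * P (ρ t₀) / c ^ 2) ≤ c ^ 2 * Λ) :
    MonotoneOn (deriv a) D := by
  refine monotoneOn_of_hasDerivWithinAt_nonneg hD hsol.continuousOn_deriv
    (fun t ht => (hsol t (interior_subset ht)).2.2.2.1.hasDerivWithinAt) ?_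
  intro t ht
  have htD := interior_subset ht
  obtain ⟨ha, hρ, -⟩ := hsol t htD
  have hρle : ρ t ≤ ρ t₀ := hsol.antitoneOn_density hP hD hv ht₀.1 htD (ht₀.2 htD)
  have hPle : P (ρ t) ≤ P (ρ t₀) := hP.monotoneOn hρ (hρ.trans_le hρle) hρle
  have hle : 4 * Real.pi * G * (ρ t + 3 * P (ρ t) / c ^ 2)
      ≤ 4 * Real.pi * G * (ρ t₀ + 3 * P (ρ t₀) / c ^ 2) := by
    have := Real.pi_pos
    gcongr
  exact mul_nonneg (by linarith) ha.le

lemma deriv_pos {T : ℝ} (hG : 0 < G) (hP : A0 c P)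
    (hsol : IsFriedmannSolution c G Λ P a ρ (Set.Ico 0 T)) (h₀ : 0 < deriv a 0)
    (hcond : 4 * Real.pi * G * (ρ 0 + 3 * P (ρ 0) / c ^ 2) ≤ c ^ 2 * Λ) :
    ∀ t ∈ Set.Ico 0 T, 0 < deriv a t := by
  by_contra! hneg
  obtain ⟨t₁, ht₁, hle⟩ := hneg
  have hsub : Set.Icc 0 t₁ ⊆ Set.Ico 0 T := fun x hx => ⟨hx.1, hx.2.trans_lt ht₁.2⟩
  have hclosed : IsClosed (Set.Icc 0 t₁ ∩ deriv a ⁻¹' Set.Iic 0) :=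
    (hsol.mono hsub).continuousOn_deriv.preimage_isClosed_of_isClosed isClosed_Icc isClosed_Iic
  obtain ⟨τ, ⟨hτ, hτle⟩, hmin⟩ :=
    (isCompact_Icc.of_isClosed_subset hclosed Set.inter_subset_left).exists_isLeast
      ⟨t₁, ⟨ht₁.1, le_rfl⟩, hle⟩
  have hsub' : Set.Icc 0 τ ⊆ Set.Ico 0 T :=
    fun x hx => ⟨hx.1, (hx.2.trans hτ.2).trans_lt ht₁.2⟩
  have hv : ∀ t ∈ interior (Set.Icc 0 τ), 0 ≤ deriv a t := by
    rw [interior_Icc]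
    intro t ht
    by_contra! hlt
    exact ht.2.not_ge (hmin ⟨⟨ht.1.le, ht.2.le.trans hτ.2⟩, hlt.le⟩)
  have hmono := (hsol.mono hsub').monotoneOn_deriv hG hP (convex_Icc 0 τ) hv
    (isLeast_Icc hτ.1) hcond
  have : deriv a 0 ≤ deriv a τ := hmono ⟨le_rfl, hτ.1⟩ ⟨hτ.1, le_rfl⟩ hτ.1
  exact absurd hτle (by simpa using h₀.trans_le this)

/-- Expansion is at most exponential, at the rate set by the cosmological constant. -/
lemma antitoneOn_mul_exp (hG : 0 < G) (hΛ : 0 < Λ) (hP : A0 c P)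
    (hsol : IsFriedmannSolution c G Λ P a ρ D) (hD : Convex ℝ D) :
    AntitoneOn (fun t => (deriv a t + √(c ^ 2 * Λ / 3) * a t) *
      Real.exp (-√(c ^ 2 * Λ / 3) * t)) D := by
  set k := √(c ^ 2 * Λ / 3)
  have hksq : k ^ 2 = c ^ 2 * Λ / 3 := Real.sq_sqrt (by positivity)
  have hder : ∀ t ∈ D, HasDerivAt (fun t => (deriv a t + k * a t) * Real.exp (-k * t))
      (-(4 * Real.pi * G / 3) * (ρ t + 3 * P (ρ t) / c ^ 2) * a t * Real.exp (-k * t)) t := by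
    intro t ht
    obtain ⟨-, -, h₁, h₂, -⟩ := hsol t ht
    refine ((h₂.fun_add (h₁.hasDerivAt.const_mul k)).fun_mul
      (((hasDerivAt_id t).const_mul (-k)).exp)).congr_deriv ?_
    rw [← hksq]
    simp only [id]
    ring
  refine antitoneOn_of_hasDerivWithinAt_nonpos hD
    (fun t ht => (hder t ht).continuousAt.continuousWithinAt)
    (fun t ht => (hder t (interior_subset ht)).hasDerivWithinAt) fun t ht => ?_
  obtain ⟨ha, hρ, -⟩ := hsol t (interior_subset ht)
  have hPρ := hP.2.1 _ hρ
  have hpi := Real.pi_pos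
  have : 0 ≤ 4 * Real.pi * G / 3 * (ρ t + 3 * P (ρ t) / c ^ 2) * a t * Real.exp (-k * t) := by
    positivity
  linarith

/-- An expanding accelerating solution on `[0, T[` with `T` finite has limits at `T` inside the
domain of the system. -/
lemma exists_tendsto {T : ℝ} (hT : 0 < T) (hc : 0 < c) (hG : 0 < G) (hΛ : 0 < Λ) (hP : A0 c P)
    (hsol : IsFriedmannSolution c G Λ P a ρ (Set.Ico 0 T)) (h₀ : 0 < deriv a 0)
    (hcond : 4 * Real.pi * G * (ρ 0 + 3 * P (ρ 0) / c ^ 2) ≤ c ^ 2 * Λ) :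
    ∃ A V R : ℝ, 0 < A ∧ 0 < R ∧ Tendsto a (𝓝[<] T) (𝓝 A) ∧
      Tendsto (deriv a) (𝓝[<] T) (𝓝 V) ∧ Tendsto ρ (𝓝[<] T) (𝓝 R) := by
  have hv := hsol.deriv_pos hG hP h₀ hcond
  have hv' : ∀ t ∈ interior (Set.Ico 0 T), 0 ≤ deriv a t :=
    fun t ht => (hv t (interior_subset ht)).le
  have hD : Convex ℝ (Set.Ico 0 T) := convex_Ico 0 T
  have hmem₀ : (0 : ℝ) ∈ Set.Ico 0 T := ⟨le_rfl, hT⟩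
  have ha := hsol.monotoneOn_scale hD hv'
  have hda := hsol.monotoneOn_deriv hG hP hD hv' (isLeast_Ico hT) hcond
  have hρ := hsol.antitoneOn_density hP hD hv'
  have hsix := hsol.monotoneOn_density_mul_pow_six hc hP hD hv'
  have hexp := hsol.antitoneOn_mul_exp hG hΛ hP hD
  set k := √(c ^ 2 * Λ / 3)
  have hkpos : 0 < k := Real.sqrt_pos.mpr (by positivity)
  obtain ⟨ha₀, hρ₀, -⟩ := hsol 0 hmem₀
  set C := (deriv a 0 + k * a 0) * Real.exp (k * T)
  have hbound : ∀ t ∈ Set.Ico 0 T, deriv a t + k * a t ≤ C := by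
    intro t ht
    have h : (deriv a t + k * a t) * Real.exp (-k * t) ≤ deriv a 0 + k * a 0 := by
      simpa using hexp hmem₀ ht ht.1
    calc deriv a t + k * a t
        = (deriv a t + k * a t) * Real.exp (-k * t) * Real.exp (k * t) := by
          rw [mul_assoc, ← Real.exp_add]; simp
      _ ≤ (deriv a 0 + k * a 0) * Real.exp (k * T) := by
          gcongr
          exact ht.2.le
  have hab : ∀ t ∈ Set.Ico 0 T, a t ≤ C / k := by
    intro t ht
    rw [le_div_iff₀ hkpos]
    linarith [hbound t ht, hv t ht]
  have hdab : ∀ t ∈ Set.Ico 0 T, deriv a t ≤ C := by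
    intro t ht
    have := mul_pos hkpos (hsol t ht).1
    linarith [hbound t ht]
  have hCk : 0 < C / k := ha₀.trans_le (hab 0 hmem₀)
  have hρb : ∀ t ∈ Set.Ico 0 T, ρ 0 * a 0 ^ 6 / (C / k) ^ 6 ≤ ρ t := by
    intro t ht
    obtain ⟨hat, hρt, -⟩ := hsol t ht
    rw [div_le_iff₀ (by positivity)]
    calc ρ 0 * a 0 ^ 6 ≤ ρ t * a t ^ 6 := hsix hmem₀ ht ht.1
      _ ≤ ρ t * (C / k) ^ 6 := by
        gcongr
        exact hab t ht
  have hρlow : 0 < ρ 0 * a 0 ^ 6 / (C / k) ^ 6 := by positivity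
  have hsub : Set.Ioo 0 T ⊆ Set.Ico 0 T := Ioo_subset_Ico_self
  have hne : (Set.Ioo 0 T).Nonempty := nonempty_Ioo.mpr hT
  have hnhds : Set.Ioo 0 T ∈ 𝓝[<] T := Ioo_mem_nhdsLT hT
  have hlima := (ha.mono hsub).tendsto_nhdsWithin_Ioo_left hne
    ⟨C / k, by rintro _ ⟨t, ht, rfl⟩; exact hab t (hsub ht)⟩
  have hlimv := (hda.mono hsub).tendsto_nhdsWithin_Ioo_left hne
    ⟨C, by rintro _ ⟨t, ht, rfl⟩; exact hdab t (hsub ht)⟩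
  have hlimρ := (hρ.mono hsub).tendsto_nhdsWithin_Ioo_left hne
    ⟨_, by rintro _ ⟨t, ht, rfl⟩; exact hρb t (hsub ht)⟩
  refine ⟨_, _, _, ha₀.trans_le (ge_of_tendsto hlima ?_),
    hρlow.trans_le (ge_of_tendsto hlimρ ?_), hlima, hlimv, hlimρ⟩
  · filter_upwards [hnhds] with t ht
    exact ha hmem₀ (hsub ht) ht.1.le
  · filter_upwards [hnhds] with t ht
    exact hρb t (hsub ht)

/-- A global expanding accelerating solution expands without bound and dilutes. -/
lemma tendsto_atTop (hG : 0 < G) (hP : A0 c P)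
    (hsol : IsFriedmannSolution c G Λ P a ρ (Set.Ici 0)) (h₀ : 0 < deriv a 0)
    (hcond : 4 * Real.pi * G * (ρ 0 + 3 * P (ρ 0) / c ^ 2) ≤ c ^ 2 * Λ) :
    Tendsto a atTop atTop ∧ Tendsto ρ atTop (𝓝 0) := by
  have hv : ∀ t ∈ Set.Ici (0 : ℝ), 0 < deriv a t := fun t ht =>
    (hsol.mono Ico_subset_Ici_self).deriv_pos (T := t + 1) hG hP h₀ hcond t ⟨ht, by linarith⟩
  have hv' : ∀ t ∈ interior (Set.Ici (0 : ℝ)), 0 ≤ deriv a t :=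
    fun t ht => (hv t (interior_subset ht)).le
  have hD : Convex ℝ (Set.Ici (0 : ℝ)) := convex_Ici 0
  have hda := hsol.monotoneOn_deriv hG hP hD hv' isLeast_Ici hcond
  have hlin : ∀ t ∈ Set.Ici (0 : ℝ), deriv a 0 * t + a 0 ≤ a t := by
    intro t ht
    have hdiff : DifferentiableOn ℝ a (interior (Set.Ici 0)) := fun x hx =>
      (hsol x (interior_subset hx)).2.2.1.differentiableWithinAt
    have := hD.mul_sub_le_image_sub_of_le_deriv hsol.continuousOn_scale hdiff
      (fun x hx => hda self_mem_Ici (interior_subset hx) (interior_subset hx)) 0 self_mem_Ici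
      t ht ht
    linarith
  have ha : Tendsto a atTop atTop := by
    refine tendsto_atTop_mono' _ ?_
      (tendsto_atTop_add_const_right _ (a 0) (tendsto_id.const_mul_atTop h₀))
    filter_upwards [eventually_ge_atTop 0] with t ht
    exact hlin t ht
  refine ⟨ha, ?_⟩
  have hthree := hsol.antitoneOn_density_mul_pow hP hD hv' le_rfl
  have hlim : Tendsto (fun t => ρ 0 * a 0 ^ 3 / a t ^ 3) atTop (𝓝 0) :=
    tendsto_const_nhds.div_atTop ((tendsto_pow_atTop three_ne_zero).comp ha)
  refine tendsto_of_tendsto_of_tendsto_of_le_of_le' tendsto_const_nhds hlim ?_ ?_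
  · filter_upwards [eventually_ge_atTop 0] with t ht
    exact (hsol t ht).2.1.le
  · filter_upwards [eventually_ge_atTop 0] with t ht
    have hat := (hsol t ht).1
    rw [le_div_iff₀ (by positivity)]
    exact hthree self_mem_Ici ht ht

end IsFriedmannSolution

/-- Theorem 2 (Expanding universe): under (A0) and (A1), if `ȧ₀ > 0` and
`4πG(ρ₀ + 3P(ρ₀)/c²) ≤ c²Λ`, then `t₊ = +∞` and `a(t) → +∞`, `ρ(t) → 0`
as `t → +∞`. -/
theorem expanding_universe
    (c G Λ : ℝ) (hc : 0 < c) (hG : 0 < G) (hΛ : 0 < Λ)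
    (P : ℝ → ℝ) (hA0 : A0 c P) (hA1 : ∃ Γ σ : ℝ, A1 c P Γ σ)
    (a ρ : ℝ → ℝ) (tm tp : EReal)
    (hmax : IsMaximalSolution c G Λ P a ρ tm tp)
    (a0 adot0 ρ0 : ℝ) (ha0 : a 0 = a0) (hadot0 : deriv a 0 = adot0) (hρ0 : ρ 0 = ρ0)
    (ha0pos : 0 < a0) (hρ0pos : 0 < ρ0) (hadot0pos : 0 < adot0)
    (hcond : 4 * Real.pi * G * (ρ0 + 3 * P ρ0 / c ^ 2) ≤ c ^ 2 * Λ) :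
    tp = ⊤ ∧
      Filter.Tendsto a Filter.atTop Filter.atTop ∧
      Filter.Tendsto ρ Filter.atTop (nhds 0) := by
  subst ha0 hadot0 hρ0
  obtain ⟨htm, htp, hsol, hext⟩ := hmax
  have hglobal : tp = ⊤ := by
    by_contra hne
    lift tp to ℝ using ⟨hne, (bot_lt_iff_ne_bot.mp (bot_le.trans_lt htp))⟩ with T
    have hT : 0 < T := by exact_mod_cast htp
    obtain ⟨s, hs, hs₀⟩ := EReal.lt_iff_exists_real_btwn.mp htm
    have hs₀' : s < 0 := by exact_mod_cast hs₀
    have hIoo : IsFriedmannSolution c G Λ P a ρ (Set.Ioo s T) := hsol.mono fun t ht =>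
      ⟨hs.trans (by exact_mod_cast ht.1), by exact_mod_cast ht.2⟩
    have hIco : IsFriedmannSolution c G Λ P a ρ (Set.Ico 0 T) :=
      hIoo.mono fun t ht => ⟨hs₀'.trans_le ht.1, ht.2⟩
    obtain ⟨A, V, R, hA, hR, h₁, h₂, h₃⟩ :=
      hIco.exists_tendsto hT hc hG hΛ hA0 hadot0pos hcond
    obtain ⟨b, σ, u, hu, hb, hba, hσρ⟩ :=
      hIoo.exists_extension hA0 (hs₀'.trans hT) hA hR h₁ h₂ h₃
    have hle := (hext b σ s u hs₀' (hT.trans hu) hb (hba hT)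
      (hba.eventuallyEq_of_mem (Iio_mem_nhds hT)).deriv_eq (hσρ hT)).2
    exact hu.not_ge (by exact_mod_cast hle)
  refine ⟨hglobal, IsFriedmannSolution.tendsto_atTop hG hA0 (hsol.mono fun t ht => ?_)
    hadot0pos hcond⟩
  exact ⟨htm.trans_le (by exact_mod_cast Set.mem_Ici.mp ht), hglobal ▸ EReal.coe_lt_top t⟩
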